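/- arXiv:1903.07144 — 2 statements merged into one kernel-verified Lean document; each statement's English description precedes it below -/
import Mathlib

section
/- If G ∈ Gen T is Gorenstein π[T]-projective, then E_T^i(G, U) = 0 for all i > 0 and every module U ∈ F.Copres^1 T with finite T-injective dimension. -/
/-! Preliminaries: classes of modules relative to a module `T`, relative extension
functors `E_T^n` computed from `Prod T`-coresolutions, (Gorenstein) `π[T]`-projectivity,
`σ[T]`-injectivity, tilting modules and `T`-cocoherent rings. -/

section Preamble

variable (R : Type) [Ring R]

/-- `M ∈ Prod T`: direct summand of a direct product of copies of `T`. -/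
def MemProdT (T : Type) [AddCommGroup T] [Module R T]
    (M : Type) [AddCommGroup M] [Module R M] : Prop :=
  ∃ (I : Type) (s : M →ₗ[R] (I → T)) (r : (I → T) →ₗ[R] M), r.comp s = LinearMap.id

/-- `M ∈ Add T`: direct summand of a direct sum of copies of `T`. -/
def MemAddT (T : Type) [AddCommGroup T] [Module R T]
    (M : Type) [AddCommGroup M] [Module R M] : Prop :=
  ∃ (I : Type) (s : M →ₗ[R] (I →₀ T)) (r : (I →₀ T) →ₗ[R] M), r.comp s = LinearMap.id

/-- `M ∈ Gen T`: there is an exact sequence `T^(n) → M → 0`. -/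
def MemGenT (T : Type) [AddCommGroup T] [Module R T]
    (M : Type) [AddCommGroup M] [Module R M] : Prop :=
  ∃ (n : ℕ) (f : (Fin n → T) →ₗ[R] M), Function.Surjective f

/-- `M ∈ Cogen T`: there is an exact sequence `0 → M → T^n`. -/
def MemCogenT (T : Type) [AddCommGroup T] [Module R T]
    (M : Type) [AddCommGroup M] [Module R M] : Prop :=
  ∃ (n : ℕ) (f : M →ₗ[R] (Fin n → T)), Function.Injective f

/-- `M ∈ π[T]`: `M ≅ B/A` for submodules `A ≤ B ≤ T^I`. -/
def MemPiT (T : Type) [AddCommGroup T] [Module R T]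
    (M : Type) [AddCommGroup M] [Module R M] : Prop :=
  ∃ (I : Type) (A B : Submodule R (I → T)), A ≤ B ∧
    Nonempty (M ≃ₗ[R] (B ⧸ (A.comap B.subtype)))

/-- `M ∈ σ[T]`: `M` is subgenerated by `T`. -/
def MemSigmaT (T : Type) [AddCommGroup T] [Module R T]
    (M : Type) [AddCommGroup M] [Module R M] : Prop :=
  ∃ (I : Type) (K : Submodule R (I →₀ T)) (f : M →ₗ[R] ((I →₀ T) ⧸ K)),
    Function.Injective f

/-- A `Prod T`-coresolution `0 → M → C 0 → C 1 → ⋯` of `M`. -/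
structure Coresolution (T : Type) [AddCommGroup T] [Module R T]
    (M : Type) [AddCommGroup M] [Module R M] where
  C : ℕ → Type
  [instA : ∀ n, AddCommGroup (C n)]
  [instM : ∀ n, Module R (C n)]
  mem : ∀ n, MemProdT R T (C n)
  ι : M →ₗ[R] C 0
  d : ∀ n, C n →ₗ[R] C (n + 1)
  inj : Function.Injective ι
  exact0 : LinearMap.range ι = LinearMap.ker (d 0)
  exactd : ∀ n, LinearMap.range (d n) = LinearMap.ker (d (n + 1))

attribute [instance] Coresolution.instA Coresolution.instM

/-- Vanishing of `E_T^{n+1}(A, M)`, computed from the coresolution `c` of `M`: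
exactness of `Hom(A, C n) → Hom(A, C (n+1)) → Hom(A, C (n+2))`. -/
def EVanishSucc {T : Type} [AddCommGroup T] [Module R T]
    {M : Type} [AddCommGroup M] [Module R M] (c : Coresolution R T M) (n : ℕ)
    (A : Type) [AddCommGroup A] [Module R A] : Prop :=
  ∀ f : A →ₗ[R] c.C (n + 1), (c.d (n + 1)).comp f = 0 →
    ∃ g : A →ₗ[R] c.C n, (c.d n).comp g = f

/-- Postcomposition with a linear map, as an additive homomorphism of hom groups. -/
def homPostcomp (A : Type) [AddCommGroup A] [Module R A]
    {B C : Type} [AddCommGroup B] [Module R B] [AddCommGroup C] [Module R C]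
    (g : B →ₗ[R] C) : (A →ₗ[R] B) →+ (A →ₗ[R] C) where
  toFun f := g.comp f
  map_zero' := by ext x; simp
  map_add' f₁ f₂ := by ext x; simp

/-- Cocycles in degree `n+1` of the complex `Hom(A, C•)`. -/
def ECocycle {T : Type} [AddCommGroup T] [Module R T]
    {M : Type} [AddCommGroup M] [Module R M] (c : Coresolution R T M)
    (A : Type) [AddCommGroup A] [Module R A] (n : ℕ) :
    AddSubgroup (A →ₗ[R] c.C (n + 1)) :=
  (homPostcomp R A (c.d (n + 1))).ker

/-- Coboundaries in degree `n+1` of the complex `Hom(A, C•)`. -/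
def ECoboundary {T : Type} [AddCommGroup T] [Module R T]
    {M : Type} [AddCommGroup M] [Module R M] (c : Coresolution R T M)
    (A : Type) [AddCommGroup A] [Module R A] (n : ℕ) :
    AddSubgroup (A →ₗ[R] c.C (n + 1)) :=
  (homPostcomp R A (c.d n)).range

/-- The relative extension group `E_T^{n+1}(A, M)` computed from the coresolution `c`. -/
def EGroupSucc {T : Type} [AddCommGroup T] [Module R T]
    {M : Type} [AddCommGroup M] [Module R M] (c : Coresolution R T M)
    (A : Type) [AddCommGroup A] [Module R A] (n : ℕ) : Type :=
  ECocycle R c A n ⧸ ((ECoboundary R c A n).addSubgroupOf (ECocycle R c A n))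

noncomputable instance {T : Type} [AddCommGroup T] [Module R T]
    {M : Type} [AddCommGroup M] [Module R M] (c : Coresolution R T M)
    (A : Type) [AddCommGroup A] [Module R A] (n : ℕ) :
    AddCommGroup (EGroupSucc R c A n) := by
  unfold EGroupSucc; infer_instance

/-- `M ∈ F.Copres^n T` (after padding, witnessed by embeddings into finite powers of `T`). -/
def FCopres (T : Type) [AddCommGroup T] [Module R T] :
    ℕ → (M : Type) → [AddCommGroup M] → [Module R M] → Prop
  | 0, M, _, _ => ∃ (k : ℕ) (f : M →ₗ[R] (Fin k → T)), Function.Injective f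
  | n + 1, M, _, _ => ∃ (k : ℕ) (f : M →ₗ[R] (Fin k → T)), Function.Injective f ∧
      FCopres T n ((Fin k → T) ⧸ LinearMap.range f)

/-- `T.i.dim M ≤ n`: `M` has a finite `Prod T`-coresolution of length at most `n`. -/
def TInjDimLe (T : Type) [AddCommGroup T] [Module R T] :
    ℕ → (M : Type) → [AddCommGroup M] → [Module R M] → Prop
  | 0, M, _, _ => MemProdT R T M
  | n + 1, M, _, _ => ∃ (I : Type) (f : M →ₗ[R] (I → T)), Function.Injective f ∧
      TInjDimLe T n ((I → T) ⧸ LinearMap.range f)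

/-- `M` has finite `T`-injective dimension. -/
def FiniteTInjDim (T : Type) [AddCommGroup T] [Module R T]
    (M : Type) [AddCommGroup M] [Module R M] : Prop :=
  ∃ n, TInjDimLe R T n M

/-- `π[T].pd(M) ≤ n`: `E_T^{n+1}(M, N) = 0` for every `N ∈ π[T]`. -/
def PiTPdLe (T : Type) [AddCommGroup T] [Module R T] (n : ℕ)
    (M : Type) [AddCommGroup M] [Module R M] : Prop :=
  ∀ (N : Type) [AddCommGroup N] [Module R N], MemPiT R T N →
    ∀ c : Coresolution R T N, EVanishSucc R c n M

/-- `M` is `π[T]`-projective: `E_T^1(M, N) = 0` for every `N ∈ π[T]`. -/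
def PiTProjective (T : Type) [AddCommGroup T] [Module R T]
    (M : Type) [AddCommGroup M] [Module R M] : Prop :=
  ∀ (N : Type) [AddCommGroup N] [Module R N], MemPiT R T N →
    ∀ c : Coresolution R T N, EVanishSucc R c 0 M

/-- `M` is `T`-injective: `E_T^1(A, M) = 0` for every module `A`. -/
def TInjective (T : Type) [AddCommGroup T] [Module R T]
    (M : Type) [AddCommGroup M] [Module R M] : Prop :=
  ∀ (A : Type) [AddCommGroup A] [Module R A],
    ∀ c : Coresolution R T M, EVanishSucc R c 0 A

/-- An exact complex `⋯ → B (-1) → B 0 → B 1 → ⋯` of `π[T]`-projective modules with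
`G ≅ ker (B 0 → B 1)`. -/
structure PiTProjComplex (T : Type) [AddCommGroup T] [Module R T]
    (G : Type) [AddCommGroup G] [Module R G] where
  B : ℤ → Type
  [instA : ∀ n, AddCommGroup (B n)]
  [instM : ∀ n, Module R (B n)]
  proj : ∀ n, PiTProjective R T (B n)
  d : ∀ n, B n →ₗ[R] B (n + 1)
  exactd : ∀ n, LinearMap.range (d n) = LinearMap.ker (d (n + 1))
  kerIso : Nonempty (G ≃ₗ[R] LinearMap.ker (d 0))

attribute [instance] PiTProjComplex.instA PiTProjComplex.instM

/-- The complex `c` stays exact after applying `Hom(-, U)`. -/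
def HomIntoExact {T : Type} [AddCommGroup T] [Module R T]
    {G : Type} [AddCommGroup G] [Module R G] (c : PiTProjComplex R T G)
    (U : Type) [AddCommGroup U] [Module R U] : Prop :=
  ∀ (n : ℤ) (f : c.B (n + 1) →ₗ[R] U), f.comp (c.d n) = 0 →
    ∃ g : c.B (n + 1 + 1) →ₗ[R] U, g.comp (c.d (n + 1)) = f

/-- `G` is Gorenstein `π[T]`-projective. -/
def GorPiTProj (T : Type) [AddCommGroup T] [Module R T]
    (G : Type) [AddCommGroup G] [Module R G] : Prop :=
  MemGenT R T G ∧ ∃ c : PiTProjComplex R T G,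
    ∀ (U : Type) [AddCommGroup U] [Module R U],
      FCopres R T 1 U → FiniteTInjDim R T U → HomIntoExact R c U

/-- `R` is `T`-cocoherent: `F.Copres^0 T = F.Copres^1 T`. -/
def TCocoherent (T : Type) [AddCommGroup T] [Module R T] : Prop :=
  ∀ (M : Type) [AddCommGroup M] [Module R M], FCopres R T 0 M ↔ FCopres R T 1 M

/-- A right `π[T]`-projective resolution `0 → G → B 0 → B 1 → ⋯`. -/
structure RightPiTProjRes (T : Type) [AddCommGroup T] [Module R T]
    (G : Type) [AddCommGroup G] [Module R G] where
  B : ℕ → Type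
  [instA : ∀ n, AddCommGroup (B n)]
  [instM : ∀ n, Module R (B n)]
  proj : ∀ n, PiTProjective R T (B n)
  ι : G →ₗ[R] B 0
  d : ∀ n, B n →ₗ[R] B (n + 1)
  inj : Function.Injective ι
  exact0 : LinearMap.range ι = LinearMap.ker (d 0)
  exactd : ∀ n, LinearMap.range (d n) = LinearMap.ker (d (n + 1))

/-- A short exact sequence `0 → G → M → I → 0` with `M` `π[T]`-projective and `I`
Gorenstein `π[T]`-projective. -/
structure GorPiTSES (T : Type) [AddCommGroup T] [Module R T]
    (G : Type) [AddCommGroup G] [Module R G] where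
  M : Type
  I : Type
  [iAM : AddCommGroup M]
  [iMM : Module R M]
  [iAI : AddCommGroup I]
  [iMI : Module R I]
  projM : PiTProjective R T M
  gorI : GorPiTProj R T I
  f : G →ₗ[R] M
  g : M →ₗ[R] I
  inj : Function.Injective f
  exact : LinearMap.range f = LinearMap.ker g
  surj : Function.Surjective g

/-- A Gorenstein `π[T]`-projective resolution `0 → B n → ⋯ → B 0 → M → 0` of length `n`. -/
structure GorResChain (T : Type) [AddCommGroup T] [Module R T] (n : ℕ)
    (M : Type) [AddCommGroup M] [Module R M] where
  B : ℕ → Type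
  [instA : ∀ j, AddCommGroup (B j)]
  [instM : ∀ j, Module R (B j)]
  gor : ∀ j, j ≤ n → GorPiTProj R T (B j)
  d : ∀ j, B (j + 1) →ₗ[R] B j
  π : B 0 →ₗ[R] M
  surj : Function.Surjective π
  exact0 : LinearMap.range (d 0) = LinearMap.ker π
  exactd : ∀ j, j + 1 ≤ n → LinearMap.range (d (j + 1)) = LinearMap.ker (d j)
  dtop : d n = 0

/-- `GT`-`pd(M) ≤ n`. -/
def GTPdLe (T : Type) [AddCommGroup T] [Module R T] (n : ℕ)
    (M : Type) [AddCommGroup M] [Module R M] : Prop :=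
  Nonempty (GorResChain R T n M)

/-- An exact sequence `0 → N → G (n-1) → ⋯ → G 0 → G → 0` (here `C (j+1) = G j` for
`j < n`, `C 0 ≅ G` and `C (n+1) ≅ N`) whose intermediate terms lie in `Gen T` and are
Gorenstein `π[T]`-projective. -/
structure GorLeftRes (T : Type) [AddCommGroup T] [Module R T] (n : ℕ)
    (N : Type) [AddCommGroup N] [Module R N]
    (G : Type) [AddCommGroup G] [Module R G] where
  C : ℕ → Type
  [instA : ∀ j, AddCommGroup (C j)]
  [instM : ∀ j, Module R (C j)]
  gor : ∀ j, 1 ≤ j → j ≤ n → MemGenT R T (C j) ∧ GorPiTProj R T (C j)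
  δ : ∀ j, C (j + 1) →ₗ[R] C j
  isoG : Nonempty (G ≃ₗ[R] C 0)
  isoN : Nonempty (N ≃ₗ[R] C (n + 1))
  surj0 : Function.Surjective (δ 0)
  injTop : Function.Injective (δ n)
  exact : ∀ j, j + 1 ≤ n → LinearMap.range (δ (j + 1)) = LinearMap.ker (δ j)

/-- `G` is an injective object of `σ[T]`. -/
def SigmaTInjective (T : Type) [AddCommGroup T] [Module R T]
    (G : Type) [AddCommGroup G] [Module R G] : Prop :=
  MemSigmaT R T G ∧
    ∀ (M N : Type) [AddCommGroup M] [Module R M] [AddCommGroup N] [Module R N],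
      MemSigmaT R T M → MemSigmaT R T N → ∀ (i : M →ₗ[R] N), Function.Injective i →
        ∀ f : M →ₗ[R] G, ∃ g : N →ₗ[R] G, g.comp i = f

/-- `M ∈ Pres¹ T`: there is an exact sequence `T^{(J)} → T^{(I)} → M → 0`. -/
def MemPres1T (T : Type) [AddCommGroup T] [Module R T]
    (M : Type) [AddCommGroup M] [Module R M] : Prop :=
  ∃ (I : Type) (g : (I →₀ T) →ₗ[R] M), Function.Surjective g ∧
    ∃ (J : Type) (h : (J →₀ T) →ₗ[R] (I →₀ T)),
      LinearMap.range h = LinearMap.ker g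

/-- `T.p.dim M ≤ n`: `M` has a finite `Add T`-resolution of length at most `n`. -/
def TProjDimLe (T : Type) [AddCommGroup T] [Module R T] :
    ℕ → (M : Type) → [AddCommGroup M] → [Module R M] → Prop
  | 0, M, _, _ => MemAddT R T M
  | n + 1, M, _, _ => ∃ (I : Type) (g : (I →₀ T) →ₗ[R] M), Function.Surjective g ∧
      TProjDimLe T n (LinearMap.ker g)

/-- `M` has finite `T`-projective dimension. -/
def FiniteTProjDim (T : Type) [AddCommGroup T] [Module R T]
    (M : Type) [AddCommGroup M] [Module R M] : Prop :=
  ∃ n, TProjDimLe R T n M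

/-- An exact complex of `σ[T]`-injective modules with `G ≅ ker (A 0 → A 1)`. -/
structure SigmaInjComplex (T : Type) [AddCommGroup T] [Module R T]
    (G : Type) [AddCommGroup G] [Module R G] where
  A : ℤ → Type
  [instA : ∀ n, AddCommGroup (A n)]
  [instM : ∀ n, Module R (A n)]
  sinj : ∀ n, SigmaTInjective R T (A n)
  d : ∀ n, A n →ₗ[R] A (n + 1)
  exactd : ∀ n, LinearMap.range (d n) = LinearMap.ker (d (n + 1))
  kerIso : Nonempty (G ≃ₗ[R] LinearMap.ker (d 0))

attribute [instance] SigmaInjComplex.instA SigmaInjComplex.instM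

/-- The complex `c` stays exact after applying `Hom(U, -)`. -/
def HomFromExact {T : Type} [AddCommGroup T] [Module R T]
    {G : Type} [AddCommGroup G] [Module R G] (c : SigmaInjComplex R T G)
    (U : Type) [AddCommGroup U] [Module R U] : Prop :=
  ∀ (n : ℤ) (f : U →ₗ[R] c.A (n + 1)), (c.d (n + 1)).comp f = 0 →
    ∃ g : U →ₗ[R] c.A n, (c.d n).comp g = f

/-- `G` is Gorenstein `σ[T]`-injective. -/
def GorSigmaTInj (T : Type) [AddCommGroup T] [Module R T]
    (G : Type) [AddCommGroup G] [Module R G] : Prop :=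
  ∃ c : SigmaInjComplex R T G,
    ∀ (U : Type) [AddCommGroup U] [Module R U],
      MemPres1T R T U → FiniteTProjDim R T U → HomFromExact R c U

/-- A projective resolution `0 → P₁ → P₀ → M → 0` of length at most one. -/
structure PdLeOneWitness (M : Type) [AddCommGroup M] [Module R M] where
  P0 : Type
  P1 : Type
  [iA0 : AddCommGroup P0]
  [iM0 : Module R P0]
  [iA1 : AddCommGroup P1]
  [iM1 : Module R P1]
  proj0 : Module.Projective R P0
  proj1 : Module.Projective R P1
  f : P1 →ₗ[R] P0
  g : P0 →ₗ[R] M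
  inj : Function.Injective f
  exact : LinearMap.range f = LinearMap.ker g
  surj : Function.Surjective g

/-- `Ext^1(T, T^{(I)}) = 0` for all index sets `I`: every short exact sequence
`0 → T^{(I)} → Y → T → 0` splits.  (Together with `pd T ≤ 1` this is equivalent to
`Ext^i(T, T^{(λ)}) = 0` for all `i > 0`.) -/
def ExtOneSelfVanish (T : Type) [AddCommGroup T] [Module R T] : Prop :=
  ∀ (I : Type) (Y : Type) [AddCommGroup Y] [Module R Y]
    (f : (I →₀ T) →ₗ[R] Y) (g : Y →ₗ[R] T), Function.Injective f →
    LinearMap.range f = LinearMap.ker g → Function.Surjective g →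
    ∃ s : T →ₗ[R] Y, g.comp s = LinearMap.id

/-- An exact sequence `0 → R → T₀ → T₁ → 0` with `T₀, T₁ ∈ Add T`. -/
structure TiltingCWitness (T : Type) [AddCommGroup T] [Module R T] where
  T0 : Type
  T1 : Type
  [iA0 : AddCommGroup T0]
  [iM0 : Module R T0]
  [iA1 : AddCommGroup T1]
  [iM1 : Module R T1]
  mem0 : MemAddT R T T0
  mem1 : MemAddT R T T1
  f : R →ₗ[R] T0
  g : T0 →ₗ[R] T1
  inj : Function.Injective f
  exact : LinearMap.range f = LinearMap.ker g
  surj : Function.Surjective g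

/-- `T` is a (1-)tilting module. -/
def IsTilting (T : Type) [AddCommGroup T] [Module R T] : Prop :=
  Nonempty (PdLeOneWitness R T) ∧ ExtOneSelfVanish R T ∧ Nonempty (TiltingCWitness R T)

end Preamble

section Helpers

variable {R : Type} [Ring R] {T : Type} [AddCommGroup T] [Module R T]

theorem aux_exists_factor {A B C : Type} [AddCommGroup A] [Module R A] [AddCommGroup B] [Module R B]
    [AddCommGroup C] [Module R C] (p : A →ₗ[R] B) (hp : Function.Surjective p) (q : A →ₗ[R] C)
    (h : LinearMap.ker p ≤ LinearMap.ker q) : ∃ g : B →ₗ[R] C, g.comp p = q := by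
  refine ⟨((LinearMap.ker p).liftQ q h).comp (p.quotKerEquivOfSurjective hp).symm.toLinearMap, ?_⟩
  ext x
  have : (p.quotKerEquivOfSurjective hp).symm (p x) = (LinearMap.ker p).mkQ x := by
    rw [LinearEquiv.symm_apply_eq]
    rfl
  simp [this]

theorem aux_memPi {I N : Type} [AddCommGroup N] [Module R N]
    (s : N →ₗ[R] (I → T)) (hs : Function.Injective s) : MemPiT R T N := by
  refine ⟨I, ⊥, LinearMap.range s, bot_le, ⟨(LinearEquiv.ofInjective s hs).trans
    (Submodule.quotEquivOfEqBot _ ?_).symm⟩⟩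
  rw [Submodule.comap_bot]
  exact Submodule.ker_subtype _

/-- The coresolution of the `i`-th cosyzygy. -/
def auxShift {M : Type} [AddCommGroup M] [Module R M] (c : Coresolution R T M) (i : ℕ) :
    Coresolution R T (LinearMap.ker (c.d i)) where
  C n := c.C (i + n)
  mem n := c.mem (i + n)
  ι := (LinearMap.ker (c.d i)).subtype
  d n := c.d (i + n)
  inj := Subtype.val_injective
  exact0 := Submodule.range_subtype _
  exactd n := c.exactd (i + n)

theorem aux_lift {M : Type} [AddCommGroup M] [Module R M] (c : Coresolution R T M) (i : ℕ)
    {B : Type} [AddCommGroup B] [Module R B] (hB : PiTProjective R T B) :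
    EVanishSucc R c i B := by
  obtain ⟨I, s, r, hrs⟩ := c.mem i
  have hs : Function.Injective s := by
    intro x y hxy
    have := congrArg r hxy
    simpa [← LinearMap.comp_apply, hrs] using this
  have hmem : MemPiT R T (LinearMap.ker (c.d i)) :=
    aux_memPi (s.comp (LinearMap.ker (c.d i)).subtype) (hs.comp Subtype.val_injective)
  exact hB _ hmem (auxShift c i)

theorem aux_T : FCopres R T 1 T ∧ FiniteTInjDim R T T := by
  constructor
  · refine ⟨1, LinearMap.pi fun _ => LinearMap.id, ?_, 0, 0, ?_⟩
    · intro x y h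
      exact congrFun h 0
    · have htop : LinearMap.range (LinearMap.pi fun _ : Fin 1 => (LinearMap.id : T →ₗ[R] T)) = ⊤ := by
        rw [LinearMap.range_eq_top]
        intro v
        refine ⟨v 0, ?_⟩
        ext j
        simp [Subsingleton.elim j 0]
      have := Submodule.Quotient.subsingleton_iff.mpr htop
      exact Function.injective_of_subsingleton _
  · exact ⟨0, Unit, LinearMap.pi fun _ => LinearMap.id, LinearMap.proj (), rfl⟩

theorem aux_prod {G : Type} [AddCommGroup G] [Module R G] (b : PiTProjComplex R T G)
    (hT : HomIntoExact R b T) {C : Type} [AddCommGroup C] [Module R C] (hC : MemProdT R T C) :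
    HomIntoExact R b C := by
  obtain ⟨I, s, r, hrs⟩ := hC
  intro n f hf
  have key : ∀ j : I, ∃ g : b.B (n + 1 + 1) →ₗ[R] T,
      g.comp (b.d (n + 1)) = (LinearMap.proj j).comp (s.comp f) := by
    intro j
    refine hT n _ ?_
    rw [LinearMap.comp_assoc, LinearMap.comp_assoc, hf]
    simp
  choose g hg using key
  refine ⟨r.comp (LinearMap.pi g), ?_⟩
  have : (LinearMap.pi g).comp (b.d (n + 1)) = s.comp f := by
    ext x j
    exact LinearMap.congr_fun (hg j) x
  rw [LinearMap.comp_assoc, this, ← LinearMap.comp_assoc, hrs, LinearMap.id_comp]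

theorem aux_dd {M : Type} [AddCommGroup M] [Module R M] (c : Coresolution R T M) (i : ℕ) :
    (c.d (i + 1)).comp (c.d i) = 0 :=
  LinearMap.range_le_ker_iff.mp (c.exactd i).le

theorem aux_bdd {G : Type} [AddCommGroup G] [Module R G] (b : PiTProjComplex R T G) (n : ℤ) :
    (b.d (n + 1)).comp (b.d n) = 0 :=
  LinearMap.range_le_ker_iff.mp (b.exactd n).le

/-- `Hom(B, Zⁱ)` is exact for every cosyzygy `Zⁱ` of `U`. -/
theorem aux_syz {G : Type} [AddCommGroup G] [Module R G] (b : PiTProjComplex R T G)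
    (hT : HomIntoExact R b T) {U : Type} [AddCommGroup U] [Module R U]
    (hU : HomIntoExact R b U) (c : Coresolution R T U) (i : ℕ) :
    ∀ (n : ℤ) (φ : b.B (n + 1) →ₗ[R] c.C i), (c.d i).comp φ = 0 → φ.comp (b.d n) = 0 →
      ∃ h : b.B (n + 1 + 1) →ₗ[R] c.C i, (c.d i).comp h = 0 ∧ h.comp (b.d (n + 1)) = φ := by
  induction i with
  | zero =>
    intro n φ h1 h2
    have hr : ∀ x, φ x ∈ LinearMap.range c.ι := by
      intro x
      rw [c.exact0]
      exact LinearMap.congr_fun h1 x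
    let e := LinearEquiv.ofInjective c.ι c.inj
    let φ' : b.B (n + 1) →ₗ[R] U := e.symm.toLinearMap.comp (φ.codRestrict _ hr)
    have hφ' : c.ι.comp φ' = φ := by
      ext x
      have : e (φ' x) = φ.codRestrict _ hr x := e.apply_symm_apply _
      exact congrArg Subtype.val this
    obtain ⟨g, hg⟩ := hU n φ' (by
      ext x
      apply c.inj
      have := LinearMap.congr_fun hφ' (b.d n x)
      have h3 := LinearMap.congr_fun h2 x
      simp only [LinearMap.comp_apply, LinearMap.zero_apply, map_zero] at *
      rw [this, h3])
    refine ⟨c.ι.comp g, ?_, ?_⟩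
    · rw [← LinearMap.comp_assoc, LinearMap.range_le_ker_iff.mp c.exact0.le, LinearMap.zero_comp]
    · rw [LinearMap.comp_assoc, hg, hφ']
  | succ i ih =>
    intro n φ h1 h2
    obtain ⟨m, rfl⟩ : ∃ m, n = m + 1 := ⟨n - 1, by ring⟩
    obtain ⟨ψ, hψ⟩ := aux_lift c i (b.proj _) φ h1
    obtain ⟨h, hh1, hh2⟩ := ih m (ψ.comp (b.d (m + 1)))
      (by rw [← LinearMap.comp_assoc, hψ, h2])
      (by rw [LinearMap.comp_assoc, aux_bdd, LinearMap.comp_zero])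
    obtain ⟨k, hk⟩ := aux_prod b hT (c.mem i) (m + 1) (ψ - h)
      (by rw [LinearMap.sub_comp, hh2, sub_self])
    refine ⟨(c.d i).comp k, ?_, ?_⟩
    · rw [← LinearMap.comp_assoc, aux_dd, LinearMap.zero_comp]
    · rw [LinearMap.comp_assoc, hk, LinearMap.comp_sub, hh1, hψ, sub_zero]

theorem aux_main {G : Type} [AddCommGroup G] [Module R G] (b : PiTProjComplex R T G)
    (hT : HomIntoExact R b T) {U : Type} [AddCommGroup U] [Module R U]
    (hU : HomIntoExact R b U) (c : Coresolution R T U) (i : ℕ)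
    (z : ℤ) (e : G ≃ₗ[R] LinearMap.ker (b.d z)) : EVanishSucc R c i G := by
  obtain ⟨m, rfl⟩ : ∃ m, z = m + 1 + 1 + 1 := ⟨z - 3, by ring⟩
  intro f hf
  have hmem : ∀ x, b.d (m + 1 + 1) x ∈ LinearMap.ker (b.d (m + 1 + 1 + 1)) := fun x =>
    LinearMap.congr_fun (aux_bdd b (m + 1 + 1)) x
  let p : b.B (m + 1 + 1) →ₗ[R] G := e.symm.toLinearMap.comp ((b.d (m + 1 + 1)).codRestrict _ hmem)
  have hp : Function.Surjective p := by
    refine e.symm.surjective.comp ?_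
    rintro ⟨y, hy⟩
    rw [← b.exactd] at hy
    obtain ⟨x, rfl⟩ := hy
    exact ⟨x, rfl⟩
  have hker : LinearMap.ker p = LinearMap.range (b.d (m + 1)) := by
    rw [b.exactd]
    ext x
    simp [p, LinearMap.mem_ker, Subtype.ext_iff]
  have hpd : p.comp (b.d (m + 1)) = 0 := LinearMap.range_le_ker_iff.mp hker.ge
  obtain ⟨ψ, hψ⟩ := aux_lift c i (b.proj _) (f.comp p)
    (by rw [← LinearMap.comp_assoc, hf, LinearMap.zero_comp])
  obtain ⟨h, hh1, hh2⟩ := aux_syz b hT hU c i m (ψ.comp (b.d (m + 1)))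
    (by rw [← LinearMap.comp_assoc, hψ, LinearMap.comp_assoc, hpd, LinearMap.comp_zero])
    (by rw [LinearMap.comp_assoc, aux_bdd, LinearMap.comp_zero])
  obtain ⟨g, hg⟩ := aux_exists_factor p hp (ψ - h) (by
    rw [hker, LinearMap.range_le_ker_iff, LinearMap.sub_comp, hh2, sub_self])
  refine ⟨g, ?_⟩
  have : ((c.d i).comp g).comp p = f.comp p := by
    rw [LinearMap.comp_assoc, hg, LinearMap.comp_sub, hh1, hψ, sub_zero]
  exact (LinearMap.cancel_right hp).mp this

end Helpers

/-- If `G ∈ Gen T` is Gorenstein `π[T]`-projective, then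
`E_T^i(G, U) = 0` for all `i > 0` and all `U ∈ F.Copres^1 T` of finite `T`-injective
dimension. -/
theorem evanish_of_gorPiTProj (R : Type) [Ring R] (T : Type) [AddCommGroup T] [Module R T]
    (hT : IsTilting R T) (G : Type) [AddCommGroup G] [Module R G]
    (hG : GorPiTProj R T G) :
    ∀ (U : Type) [AddCommGroup U] [Module R U], FCopres R T 1 U → FiniteTInjDim R T U →
      ∀ (c : Coresolution R T U) (i : ℕ), EVanishSucc R c i G := by
  intro U _ _ hU1 hU2 c i
  obtain ⟨-, b, hb⟩ := hG
  obtain ⟨e⟩ := b.kerIso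
  exact aux_main b (hb T aux_T.1 aux_T.2) (hb U hU1 hU2) c i 0 e
end

section
/- If the global π[T]-projective dimension of R is finite, i.e. gl.π[T].pd(R) = sup{π[T].pd(M) : M a module} < ∞, then every Gorenstein π[T]-projective module is π[T]-projective. -/
/-- One-step shift of a coresolution. -/
def coresShift {R : Type} [Ring R] {T : Type} [AddCommGroup T] [Module R T]
    {N : Type} [AddCommGroup N] [Module R N] (c : Coresolution R T N) :
    Coresolution R T (LinearMap.ker (c.d 1)) where
  C n := c.C (n + 1)
  mem n := c.mem (n + 1)
  ι := (LinearMap.ker (c.d 1)).subtype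
  d n := c.d (n + 1)
  inj := Subtype.val_injective
  exact0 := Submodule.range_subtype _
  exactd n := c.exactd (n + 1)

theorem memPiT_of_injective {R : Type} [Ring R] {T : Type} [AddCommGroup T] [Module R T]
    {N : Type} [AddCommGroup N] [Module R N] {I : Type} (f : N →ₗ[R] (I → T))
    (hf : Function.Injective f) : MemPiT R T N := by
  refine ⟨I, ⊥, LinearMap.range f, bot_le, ⟨?_⟩⟩
  have h : (⊥ : Submodule R (I → T)).comap (LinearMap.range f).subtype = ⊥ := by
    ext x; simp
  exact (LinearEquiv.ofInjective f hf).trans (Submodule.quotEquivOfEqBot _ h).symm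

theorem memPiT_ker {R : Type} [Ring R] {T : Type} [AddCommGroup T] [Module R T]
    {X Y : Type} [AddCommGroup X] [Module R X] [AddCommGroup Y] [Module R Y]
    (hX : MemProdT R T X) (g : X →ₗ[R] Y) : MemPiT R T (LinearMap.ker g) := by
  obtain ⟨I, s, r, h⟩ := hX
  refine memPiT_of_injective (s.comp (LinearMap.ker g).subtype) ?_
  have hs : Function.Injective s :=
    Function.LeftInverse.injective (g := r) (fun x => LinearMap.congr_fun h x)
  exact hs.comp Subtype.val_injective

theorem eVanish_of_proj {R : Type} [Ring R] {T : Type} [AddCommGroup T] [Module R T]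
    {B : Type} [AddCommGroup B] [Module R B] (hB : PiTProjective R T B) (k : ℕ) :
    ∀ (N : Type) [AddCommGroup N] [Module R N], MemPiT R T N →
      ∀ c : Coresolution R T N, EVanishSucc R c k B := by
  induction k with
  | zero => exact fun N _ _ hN c => hB N hN c
  | succ k ih =>
    intro N _ _ hN c
    exact ih _ (memPiT_ker (c.mem 1) (c.d 1)) (coresShift c)

/-- `Hom(-, X)` stays exact on the complex for `X ∈ Prod T`. -/
theorem homIntoExact_prod {R : Type} [Ring R] {T : Type} [AddCommGroup T] [Module R T]
    {G : Type} [AddCommGroup G] [Module R G] (c : PiTProjComplex R T G)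
    (hc : HomIntoExact R c T) (X : Type) [AddCommGroup X] [Module R X]
    (hX : MemProdT R T X) : HomIntoExact R c X := by
  obtain ⟨I, s, r, h⟩ := hX
  intro n f hf
  have H : ∀ i : I, ∃ g : c.B (n + 1 + 1) →ₗ[R] T,
      g.comp (c.d (n + 1)) = (LinearMap.proj i).comp (s.comp f) := by
    intro i
    apply hc
    rw [LinearMap.comp_assoc, LinearMap.comp_assoc, hf]
    simp
  choose g hg using H
  refine ⟨r.comp (LinearMap.pi g), ?_⟩
  ext x
  have h1 : LinearMap.pi g (c.d (n + 1) x) = s (f x) := by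
    funext i
    exact LinearMap.congr_fun (hg i) x
  have h2 := LinearMap.congr_fun h (f x)
  simp only [LinearMap.comp_apply, h1]
  exact h2

theorem extend_from_ker {R : Type} [Ring R] {T : Type} [AddCommGroup T] [Module R T]
    {G : Type} [AddCommGroup G] [Module R G] (c : PiTProjComplex R T G)
    (X : Type) [AddCommGroup X] [Module R X] (hc : HomIntoExact R c X)
    (n : ℤ) (f : LinearMap.ker (c.d n) →ₗ[R] X) :
    ∃ F : c.B n →ₗ[R] X, F.comp (LinearMap.ker (c.d n)).subtype = f := by
  obtain ⟨j, rfl⟩ : ∃ j : ℤ, n = j + 1 + 1 := ⟨n - 2, by ring⟩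
  have hmem : ∀ x, c.d (j + 1) x ∈ LinearMap.ker (c.d (j + 1 + 1)) := fun x => by
    rw [← c.exactd]; exact ⟨x, rfl⟩
  obtain ⟨g, hg⟩ := hc j (f.comp ((c.d (j + 1)).codRestrict _ hmem)) (by
    ext x
    have : c.d (j + 1) (c.d j x) = 0 := by
      rw [← LinearMap.mem_ker, ← c.exactd]; exact ⟨x, rfl⟩
    have h2 : (c.d (j + 1)).codRestrict _ hmem (c.d j x) = 0 := Subtype.ext this
    simp only [LinearMap.comp_apply, h2, map_zero, LinearMap.zero_apply])
  refine ⟨g, ?_⟩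
  ext ⟨y, hy⟩
  have hy' := hy
  rw [← c.exactd] at hy'
  obtain ⟨x, rfl⟩ := hy'
  exact LinearMap.congr_fun hg x

theorem eVanish_step {R : Type} [Ring R] {T : Type} [AddCommGroup T] [Module R T]
    {G : Type} [AddCommGroup G] [Module R G] (c : PiTProjComplex R T G)
    (hc : HomIntoExact R c T) {N : Type} [AddCommGroup N] [Module R N]
    (hN : MemPiT R T N) (e : Coresolution R T N) (k : ℕ) (n : ℤ)
    (h : EVanishSucc R e (k + 1) (LinearMap.ker (c.d (n + 1)))) :
    EVanishSucc R e k (LinearMap.ker (c.d n)) := by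
  intro f hf
  obtain ⟨F, hF⟩ := extend_from_ker c _ (homIntoExact_prod c hc _ (e.mem (k + 1))) n f
  have hmem : ∀ x, c.d n x ∈ LinearMap.ker (c.d (n + 1)) := fun x => by
    rw [← c.exactd]; exact ⟨x, rfl⟩
  let p : c.B n →ₗ[R] LinearMap.ker (c.d (n + 1)) := (c.d n).codRestrict _ hmem
  have hp : Function.Surjective p := by
    rintro ⟨y, hy⟩
    have hy' := hy
    rw [← c.exactd] at hy'
    obtain ⟨x, rfl⟩ := hy'
    exact ⟨x, rfl⟩
  have hFx : ∀ x : LinearMap.ker (c.d n), F x = f x := fun x => LinearMap.congr_fun hF x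
  have hle : LinearMap.ker p ≤ LinearMap.ker ((e.d (k + 1)).comp F) := by
    intro x hx
    have hx' : x ∈ LinearMap.ker (c.d n) := congrArg Subtype.val hx
    have := LinearMap.congr_fun hf ⟨x, hx'⟩
    rw [LinearMap.mem_ker, LinearMap.comp_apply]
    rw [show F x = f ⟨x, hx'⟩ from hFx ⟨x, hx'⟩]
    exact this
  let q := p.quotKerEquivOfSurjective hp
  let w : LinearMap.ker (c.d (n + 1)) →ₗ[R] e.C (k + 1 + 1) :=
    ((LinearMap.ker p).liftQ _ hle).comp q.symm.toLinearMap
  have hw : ∀ x, w (p x) = e.d (k + 1) (F x) := by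
    intro x
    have : q.symm (p x) = (LinearMap.ker p).mkQ x := by
      rw [LinearEquiv.symm_apply_eq]; rfl
    change (LinearMap.ker p).liftQ _ hle (q.symm (p x)) = _
    rw [this]; rfl
  obtain ⟨g, hg⟩ := h w (by
    ext y
    obtain ⟨x, rfl⟩ := hp y
    rw [LinearMap.comp_apply, hw, LinearMap.zero_apply, ← LinearMap.mem_ker, ← e.exactd]
    exact ⟨_, rfl⟩)
  have hg' : ∀ y, e.d (k + 1) (g y) = w y := fun y => LinearMap.congr_fun hg y
  obtain ⟨a, ha⟩ := eVanish_of_proj (c.proj n) k N hN e (F - g.comp p) (by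
    ext x
    simp only [LinearMap.comp_apply, LinearMap.sub_apply, map_sub, hg', hw, sub_self,
      LinearMap.zero_apply])
  refine ⟨a.comp (LinearMap.ker (c.d n)).subtype, ?_⟩
  ext x
  have h1 := LinearMap.congr_fun ha (x : c.B n)
  have h2 : p (x : c.B n) = 0 := Subtype.ext x.2
  simp only [LinearMap.comp_apply, LinearMap.sub_apply, h2, map_zero, sub_zero, hFx] at h1
  exact h1

theorem eVanish_descend {R : Type} [Ring R] {T : Type} [AddCommGroup T] [Module R T]
    {G : Type} [AddCommGroup G] [Module R G] (c : PiTProjComplex R T G)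
    (hc : HomIntoExact R c T) {N : Type} [AddCommGroup N] [Module R N]
    (hN : MemPiT R T N) (e : Coresolution R T N) (m : ℕ)
    (h : ∀ n : ℤ, EVanishSucc R e m (LinearMap.ker (c.d n))) :
    ∀ n : ℤ, EVanishSucc R e 0 (LinearMap.ker (c.d n)) := by
  induction m with
  | zero => exact h
  | succ k ih => exact ih fun n => eVanish_step c hc hN e k n (h (n + 1))

theorem fcopres_one_self (R : Type) [Ring R] (T : Type) [AddCommGroup T] [Module R T] :
    FCopres R T 1 T := by
  have hs : Function.Surjective (LinearMap.pi (fun _ : Fin 1 => (LinearMap.id : T →ₗ[R] T))) := by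
    intro y
    refine ⟨y 0, ?_⟩
    funext i
    rw [Subsingleton.elim i 0]; rfl
  refine ⟨1, LinearMap.pi fun _ => LinearMap.id, fun x y h => congrFun h 0, 0, 0, ?_⟩
  have : Subsingleton ((Fin 1 → T) ⧸
      LinearMap.range (LinearMap.pi (fun _ : Fin 1 => (LinearMap.id : T →ₗ[R] T)))) := by
    rw [Submodule.Quotient.subsingleton_iff, LinearMap.range_eq_top]
    exact hs
  exact fun x y _ => Subsingleton.elim x y

theorem memProdT_self (R : Type) [Ring R] (T : Type) [AddCommGroup T] [Module R T] :
    MemProdT R T T :=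
  ⟨Unit, LinearMap.pi fun _ => LinearMap.id, LinearMap.proj (), rfl⟩

/-- If the global `π[T]`-projective dimension of `R` is finite, then
every Gorenstein `π[T]`-projective module is `π[T]`-projective. -/
theorem piTProj_of_gor_of_finite_gldim (R : Type) [Ring R]
    (T : Type) [AddCommGroup T] [Module R T] (hT : IsTilting R T)
    (hfin : ∃ m : ℕ, ∀ (M : Type) [AddCommGroup M] [Module R M], PiTPdLe R T m M) :
    ∀ (G : Type) [AddCommGroup G] [Module R G], GorPiTProj R T G → PiTProjective R T G := by
  obtain ⟨m, hm⟩ := hfin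
  intro G _ _ hG N _ _ hN e f hf
  obtain ⟨_, c, hc⟩ := hG
  have hcT : HomIntoExact R c T := hc T (fcopres_one_self R T) ⟨0, memProdT_self R T⟩
  obtain ⟨φ⟩ := c.kerIso
  obtain ⟨g, hg⟩ := eVanish_descend c hcT hN e m (fun n => hm _ N hN e) 0
    (f.comp φ.symm.toLinearMap) (by rw [← LinearMap.comp_assoc, hf, LinearMap.zero_comp])
  refine ⟨g.comp φ.toLinearMap, ?_⟩
  rw [← LinearMap.comp_assoc, hg]
  ext x
  simp
end
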